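/- For every n ≥ 1, the number of elements of the lattice L_n is |L_n| = 1 + n + ∑_{a=1}^{n-1} ∑_{r=1}^{a} τ(r), where τ(r) is the number of positive divisors of r. -/

import Mathlib

open scoped Classical

/-- An arithmetic progression of integers: a finite set of the form
`{a, a+r, ..., a+(k-1)r}` with `a : ℤ`, `r ≥ 1` and `k ≥ 0` (so the empty set and all
singletons are arithmetic progressions). -/
def IsAP (s : Finset ℤ) : Prop :=
  ∃ (a r : ℤ) (k : ℕ), 1 ≤ r ∧ s = (Finset.range k).image (fun i => a + (i : ℤ) * r)

/-- The number `p_{nk}` of arithmetic progressions of cardinality `k` contained in `{1,…,n}`. -/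
noncomputable def numAP (n k : ℕ) : ℕ :=
  ((Finset.Icc (1:ℤ) (n:ℤ)).powerset.filter (fun s => IsAP s ∧ s.card = k)).card

/-- The Möbius function of the poset of arithmetic progressions ordered by inclusion,
defined by `μ(x,x) = 1` and `μ(x,y) = -∑_{x ≤ z < y} μ(x,z)`, where `z` ranges over
arithmetic progressions with `x ⊆ z ⊂ y`.  (For `x ⊆ y ⊆ {1,…,n}`, all arithmetic
progressions `z` with `x ⊆ z ⊂ y` automatically lie in `L_n`, so this is the Möbius
function of any interval `[x, y]` of the lattice `L_n`.) -/
noncomputable def apMu (x y : Finset ℤ) : ℤ :=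
  if x = y then 1
  else - ∑ z ∈ (y.powerset.filter (fun z => IsAP z ∧ x ⊆ z ∧ z ≠ y)).attach, apMu x z.1
termination_by y.card
decreasing_by
  rename_i z
  have hz := z.2
  rw [Finset.mem_filter, Finset.mem_powerset] at hz
  exact Finset.card_lt_card (lt_of_le_of_ne hz.1 hz.2.2.2)

/-- The join of `a` and `b` in the lattice of arithmetic progressions contained in `t`:
the intersection of all arithmetic progressions contained in `t` that contain `a ∪ b`,
i.e. the smallest such progression. -/
noncomputable def apJoin (t a b : Finset ℤ) : Finset ℤ :=
  t.filter (fun v => ∀ z : Finset ℤ, IsAP z → z ⊆ t → a ∪ b ⊆ z → v ∈ z)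

/-- The meet (intersection) of a finite family `S` of subsets of the top element `t`;
the meet of the empty family is `t` itself. -/
def apMeet (t : Finset ℤ) (S : Finset (Finset ℤ)) : Finset ℤ :=
  S.fold (· ⊓ ·) t id

/-- `x` is a coatom of the lattice `L_n` of arithmetic progressions contained in
`{1,…,n}`: an element distinct from the maximum `{1,…,n}` with no element strictly
between it and the maximum. -/
def IsCoatomIn (n : ℕ) (x : Finset ℤ) : Prop :=
  IsAP x ∧ x ⊆ Finset.Icc (1:ℤ) (n:ℤ) ∧ x ≠ Finset.Icc (1:ℤ) (n:ℤ) ∧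
    ∀ y : Finset ℤ, IsAP y → y ⊆ Finset.Icc (1:ℤ) (n:ℤ) → x ⊂ y → y = Finset.Icc (1:ℤ) (n:ℤ)

/-- `y` is covered by `top` in the poset of arithmetic progressions: `y < top` and there
is no arithmetic progression strictly between them. -/
def CoveredIn (top y : Finset ℤ) : Prop :=
  IsAP y ∧ y ⊂ top ∧ ¬ ∃ z : Finset ℤ, IsAP z ∧ y ⊂ z ∧ z ⊂ top

/-- `c` is a maximal chain in the lattice `L_n` of arithmetic progressions contained
in `{1,…,n}`: a chain (under inclusion) of elements of `L_n` to which no further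
element of `L_n` can be added. -/
def IsMaxChainIn (n : ℕ) (c : Finset (Finset ℤ)) : Prop :=
  (∀ s ∈ c, IsAP s ∧ s ⊆ Finset.Icc (1:ℤ) (n:ℤ)) ∧
  IsChain (· ⊆ ·) (↑c : Set (Finset ℤ)) ∧
  ∀ z : Finset ℤ, IsAP z → z ⊆ Finset.Icc (1:ℤ) (n:ℤ) →
    IsChain (· ⊆ ·) (insert z (↑c : Set (Finset ℤ))) → z ∈ c

/-- The number `b_{nk}` of chains of length `k` (i.e. totally ordered subsets with `k+1`
elements) in `L_n` that contain both `∅` and `{1,…,n}`. -/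
noncomputable def numChains (n k : ℕ) : ℕ :=
  (((Finset.Icc (1:ℤ) (n:ℤ)).powerset.filter IsAP).powerset.filter
    (fun c : Finset (Finset ℤ) => c.card = k + 1 ∧ ∅ ∈ c ∧ Finset.Icc (1:ℤ) (n:ℤ) ∈ c ∧
      IsChain (· ⊆ ·) (↑c : Set (Finset ℤ)))).card

/-- The arithmetic progression with maximum `N`, minimum `N - p.1` and difference `p.2`,
provided that `p.2` is a positive divisor of `p.1`. -/
noncomputable def apWithMax (N : ℤ) (p : (_ : ℕ) × ℕ) : Finset ℤ :=
  (Finset.Icc (N - p.1) N).filter (fun x => (p.2 : ℤ) ∣ N - x)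

theorem mem_apWithMax {N x : ℤ} {r d : ℕ} :
    x ∈ apWithMax N ⟨r, d⟩ ↔ (N - r ≤ x ∧ x ≤ N) ∧ (d : ℤ) ∣ N - x := by
  simp [apWithMax]

theorem isAP_iff {s : Finset ℤ} :
    IsAP s ↔ ∃ (a r : ℤ) (k : ℕ), 1 ≤ r ∧ ∀ x, x ∈ s ↔ ∃ i : ℕ, i < k ∧ a + (i : ℤ) * r = x := by
  simp [IsAP, Finset.ext_iff, eq_comm]

theorem IsAP.empty : IsAP ∅ := isAP_iff.2 ⟨0, 1, 0, le_rfl, by simp⟩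

theorem IsAP.singleton (a : ℤ) : IsAP {a} :=
  isAP_iff.2 ⟨a, 1, 1, le_rfl, by simp [eq_comm]⟩

theorem IsAP.apWithMax (N : ℤ) {r d : ℕ} (hd : 0 < d) (hdr : d ∣ r) :
    IsAP (apWithMax N ⟨r, d⟩) := by
  obtain ⟨m, rfl⟩ := hdr
  refine isAP_iff.2 ⟨N - (d * m : ℕ), d, m + 1, by exact_mod_cast hd, ?_⟩
  have hd' : (0 : ℤ) < d := by exact_mod_cast hd
  intro x
  rw [mem_apWithMax]
  push_cast
  constructor
  · rintro ⟨⟨h1, h2⟩, c, hc⟩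
    have hc0 : 0 ≤ c := by
      by_contra! h
      nlinarith
    have hcm : c ≤ m := by
      by_contra! h
      nlinarith
    refine ⟨(m - c).toNat, by omega, ?_⟩
    rw [Int.toNat_of_nonneg (by omega)]
    linarith
  · rintro ⟨i, hi, rfl⟩
    have hi' : (i : ℤ) ≤ m := by omega
    refine ⟨⟨by nlinarith, by nlinarith⟩, m - i, by ring⟩

theorem IsAP.eq_singleton_or_eq_apWithMax {s : Finset ℤ} (hs : IsAP s) {N : ℤ} (hN : N ∈ s)
    (hle : ∀ x ∈ s, x ≤ N) :
    s = {N} ∨ ∃ r d : ℕ, 0 < r ∧ d ∣ r ∧ N - r ∈ s ∧ s = _root_.apWithMax N ⟨r, d⟩ := by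
  obtain ⟨a, q, k, hq, hs⟩ := isAP_iff.1 hs
  obtain ⟨d, rfl⟩ := Int.eq_ofNat_of_zero_le (by omega : 0 ≤ q)
  simp only [hs] at hle
  obtain ⟨i, hi, hiN⟩ := (hs N).1 hN
  obtain ⟨m, rfl⟩ : ∃ m, k = m + 1 := ⟨k - 1, by omega⟩
  have hmN : a + (m : ℤ) * d = N := by
    have h := hle _ ⟨m, by omega, rfl⟩
    have : (i : ℤ) ≤ m := by omega
    nlinarith
  rcases Nat.eq_zero_or_pos m with rfl | hm
  · left
    ext x
    simp [hs, ← hmN, eq_comm]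
  · right
    refine ⟨d * m, d, Nat.mul_pos (by omega) hm, dvd_mul_right _ _, ?_, ?_⟩
    · exact (hs _).2 ⟨0, by omega, by push_cast; linarith⟩
    · ext x
      rw [mem_apWithMax, hs]
      push_cast
      constructor
      · rintro ⟨j, hj, rfl⟩
        have hj' : (j : ℤ) ≤ m := by omega
        exact ⟨⟨by nlinarith, by nlinarith⟩, m - j, by rw [← hmN]; ring⟩
      · rintro ⟨⟨h1, h2⟩, c, hc⟩
        have hc0 : 0 ≤ c := by
          by_contra! h
          nlinarith
        have hcm : c ≤ m := by
          by_contra! h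
          nlinarith
        refine ⟨(m - c).toNat, by omega, ?_⟩
        rw [Int.toNat_of_nonneg (by omega)]
        linarith

theorem apWithMax_injOn (N : ℤ) (t : Finset ℕ) :
    Set.InjOn (apWithMax N) (t.sigma Nat.divisors : Finset ((_ : ℕ) × ℕ)) := by
  have key : ∀ r d r' d' : ℕ, d ∈ r.divisors →
      apWithMax N ⟨r, d⟩ = apWithMax N ⟨r', d'⟩ → r ≤ r' ∧ d' ∣ d := by
    intro r d r' d' hd h
    obtain ⟨hdr, hr⟩ := Nat.mem_divisors.1 hd
    have hle := Nat.le_of_dvd (Nat.pos_of_ne_zero hr) hdr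
    have h1 : N - r ∈ apWithMax N ⟨r, d⟩ :=
      mem_apWithMax.2 ⟨by omega, by simpa using Int.natCast_dvd_natCast.2 hdr⟩
    have h2 : N - d ∈ apWithMax N ⟨r, d⟩ := mem_apWithMax.2 ⟨by omega, by simp⟩
    rw [h, mem_apWithMax] at h1 h2
    exact ⟨by omega, by simpa [Int.natCast_dvd_natCast] using h2.2⟩
  rintro ⟨r, d⟩ h ⟨r', d'⟩ h' heq
  simp only [Finset.coe_sigma, Set.mem_sigma_iff, Finset.mem_coe] at h h'
  obtain ⟨h1, h2⟩ := key r d r' d' h.2 heq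
  obtain ⟨h3, h4⟩ := key r' d' r d h'.2 heq.symm
  obtain rfl := le_antisymm h1 h3
  obtain rfl := Nat.dvd_antisymm h2 h4
  rfl

theorem filter_isAP_mem_eq (n : ℕ) :
    ((Finset.Icc (1:ℤ) ((n + 1 : ℕ):ℤ)).powerset.filter IsAP).filter
        (fun s => ((n + 1 : ℕ) : ℤ) ∈ s)
      = insert {((n + 1 : ℕ) : ℤ)}
          (((Finset.Icc 1 n).sigma Nat.divisors).image (apWithMax ((n + 1 : ℕ) : ℤ))) := by
  ext s
  simp only [Finset.mem_filter, Finset.mem_powerset, Finset.mem_insert, Finset.mem_image,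
    Finset.mem_sigma, Finset.mem_Icc, Nat.mem_divisors]
  constructor
  · rintro ⟨⟨hsub, hs⟩, hmem⟩
    refine (hs.eq_singleton_or_eq_apWithMax hmem
      fun x hx => (Finset.mem_Icc.1 (hsub hx)).2).imp id ?_
    rintro ⟨r, d, hr, hdr, hmin, rfl⟩
    have := (Finset.mem_Icc.1 (hsub hmin)).1
    exact ⟨⟨r, d⟩, ⟨⟨hr, by dsimp only; omega⟩, hdr, hr.ne'⟩, rfl⟩
  · rintro (rfl | ⟨⟨r, d⟩, ⟨⟨h1, h2⟩, hdr, hr⟩, rfl⟩)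
    · exact ⟨⟨by simp, IsAP.singleton _⟩, by simp⟩
    · dsimp only at h1 h2 hdr
      refine ⟨⟨fun x hx => ?_, IsAP.apWithMax _ (Nat.pos_of_dvd_of_pos hdr h1) hdr⟩,
        mem_apWithMax.2 ⟨by omega, by simp⟩⟩
      have := (mem_apWithMax.1 hx).1
      exact Finset.mem_Icc.2 (by omega)

theorem filter_isAP_notMem_eq (n : ℕ) :
    ((Finset.Icc (1:ℤ) ((n + 1 : ℕ):ℤ)).powerset.filter IsAP).filter
        (fun s => ¬ ((n + 1 : ℕ) : ℤ) ∈ s)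
      = (Finset.Icc (1:ℤ) (n:ℤ)).powerset.filter IsAP := by
  ext s
  simp only [Finset.mem_filter, Finset.mem_powerset]
  constructor
  · rintro ⟨⟨hsub, hs⟩, hmem⟩
    refine ⟨fun x hx => ?_, hs⟩
    have h := Finset.mem_Icc.1 (hsub hx)
    have hne : x ≠ ((n + 1 : ℕ) : ℤ) := fun e => hmem (e ▸ hx)
    exact Finset.mem_Icc.2 (by omega)
  · rintro ⟨hsub, hs⟩
    refine ⟨⟨hsub.trans (Finset.Icc_subset_Icc le_rfl (by omega)), hs⟩, fun h => ?_⟩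
    have := Finset.mem_Icc.1 (hsub h)
    omega

theorem card_filter_isAP_succ (n : ℕ) :
    ((Finset.Icc (1:ℤ) ((n + 1 : ℕ):ℤ)).powerset.filter IsAP).card
      = ((Finset.Icc (1:ℤ) (n:ℤ)).powerset.filter IsAP).card + 1
        + ∑ r ∈ Finset.Icc 1 n, r.divisors.card := by
  have hnot : ({((n + 1 : ℕ) : ℤ)} : Finset ℤ) ∉
      ((Finset.Icc 1 n).sigma Nat.divisors).image (apWithMax ((n + 1 : ℕ) : ℤ)) := by
    simp only [Finset.mem_image, Finset.mem_sigma, Finset.mem_Icc, Nat.mem_divisors]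
    rintro ⟨⟨r, d⟩, ⟨⟨h1, -⟩, hdr, -⟩, h⟩
    dsimp only at h1 hdr
    have hmem : ((n + 1 : ℕ) : ℤ) - r ∈ apWithMax ((n + 1 : ℕ) : ℤ) ⟨r, d⟩ :=
      mem_apWithMax.2 ⟨by omega, by simpa using Int.natCast_dvd_natCast.2 hdr⟩
    rw [h, Finset.mem_singleton] at hmem
    omega
  rw [← Finset.card_filter_add_card_filter_not (fun s => ((n + 1 : ℕ) : ℤ) ∈ s),
    filter_isAP_mem_eq, filter_isAP_notMem_eq, Finset.card_insert_of_notMem hnot,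
    Finset.card_image_of_injOn (apWithMax_injOn _ _), Finset.card_sigma]
  ring

/-- For `n ≥ 1`, the number of elements of `L_n` is
`1 + n + ∑_{a=1}^{n-1} ∑_{r=1}^{a} τ(r)`, where `τ(r)` is the number of positive
divisors of `r`. -/
theorem card_Ln (n : ℕ) (hn : 1 ≤ n) :
    ((Finset.Icc (1:ℤ) (n:ℤ)).powerset.filter IsAP).card
      = 1 + n + ∑ a ∈ Finset.Icc 1 (n-1), ∑ r ∈ Finset.Icc 1 a, r.divisors.card := by
  induction n, hn using Nat.le_induction with
  | base =>
    rw [card_filter_isAP_succ 0]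
    simp [Finset.filter_singleton, IsAP.empty]
  | succ n hn ih =>
    obtain ⟨m, rfl⟩ : ∃ m, n = m + 1 := ⟨n - 1, by omega⟩
    rw [card_filter_isAP_succ, ih, Nat.add_sub_cancel, Nat.add_sub_cancel,
      Finset.sum_Icc_succ_top (by omega : 1 ≤ m + 1)
        (fun a => ∑ r ∈ Finset.Icc 1 a, r.divisors.card)]
    ring
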